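/- arXiv:nlin/0009027 — 3 statements merged into one kernel-verified Lean document; each statement's English description precedes it below -/
import Mathlib

section
/- (RLL relation for the relativistic Toda chain.) Let A be a complex unital algebra, q ∈ ℂ, p ∈ ℂ with p² = q, λ ∈ ℂ, and let u, v ∈ A be invertible elements with u v = p v u. For x ∈ ℂ, x ≠ 0, let L(x) be the 2×2 matrix over A with entries L(x)₁₁ = x u − (x u)^{−1}, L(x)₁₂ = v, L(x)₂₁ = p^{−1} λ v^{−1}, L(x)₂₂ = 0. Let R(x) be the 4×4 complex matrix (rows/columns indexed by pairs (i,k), i,k ∈ {1,2}) with nonzero entries R₁₁,₁₁ = R₂₂,₂₂ = 1 − x^{−2} q, R₁₂,₁₂ = R₂₁,₂₁ = p (1 − x^{−2}), R₁₂,₂₁ = R₂₁,₁₂ = x^{−1}(1 − q). Define 4×4 matrices over A by (L₁(x))_{(i,k),(j,l)} = L(x)_{ij} δ_{kl} and (L₂(y))_{(i,k),(j,l)} = δ_{ij} L(y)_{kl}. Then for all nonzero x, y ∈ ℂ: R(x/y) · L₁(x) · L₂(y) = L₂(y) · L₁(x) · R(x/y) as 4×4 matrices over A. -/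
open Matrix Kronecker

/-- The relativistic Toda chain Lax matrix
`L(x) = [[x u − (x u)⁻¹, v], [p⁻¹ λ v⁻¹, 0]]`, where `p` is a square root of `q`. -/
noncomputable def todaLax {A : Type*} [Ring A] [Algebra ℂ A]
    (p lam : ℂ) (u v : A) [Invertible u] [Invertible v] (x : ℂ) :
    Matrix (Fin 2) (Fin 2) A :=
  !![x • u - x⁻¹ • (⅟u), v; (p⁻¹ * lam) • (⅟v), 0]

/-- The six-vertex R-matrix, rows and columns indexed by pairs `(i,k)`. -/
noncomputable def sixVertexR (q p x : ℂ) :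
    Matrix (Fin 2 × Fin 2) (Fin 2 × Fin 2) ℂ := fun i j =>
  if i = j ∧ (i = (0, 0) ∨ i = (1, 1)) then 1 - x⁻¹ ^ 2 * q
  else if i = j ∧ (i = (0, 1) ∨ i = (1, 0)) then p * (1 - x⁻¹ ^ 2)
  else if (i = (0, 1) ∧ j = (1, 0)) ∨ (i = (1, 0) ∧ j = (0, 1)) then x⁻¹ * (1 - q)
  else 0

/-- In a Weyl pair `u v = p v u`, inverting `u` inverts the parameter. -/
theorem invOf_mul_of_weyl {K A : Type*} [Field K] [Ring A] [Algebra K A] {p : K} (hp : p ≠ 0)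
    {u v : A} [Invertible u] (h : u * v = p • (v * u)) :
    ⅟u * v = p⁻¹ • (v * ⅟u) := by
  have h' : v * u = p⁻¹ • (u * v) := by rw [h, inv_smul_smul₀ hp]
  calc ⅟u * v = ⅟u * (v * u) * ⅟u := by simp [mul_assoc]
    _ = p⁻¹ • (v * ⅟u) := by rw [h']; simp

/-- In a Weyl pair `u v = p v u`, inverting `v` inverts the parameter. -/
theorem mul_invOf_of_weyl {K A : Type*} [Field K] [Ring A] [Algebra K A] {p : K} (hp : p ≠ 0)
    {u v : A} [Invertible v] (h : u * v = p • (v * u)) :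
    u * ⅟v = p⁻¹ • (⅟v * u) := by
  have h' : v * u = p⁻¹ • (u * v) := by rw [h, inv_smul_smul₀ hp]
  calc u * ⅟v = ⅟v * (v * u) * ⅟v := by simp [← mul_assoc]
    _ = p⁻¹ • (⅟v * u) := by rw [h']; simp [mul_assoc]

/-- A Weyl pair of invertible elements with parameter `0` only exists in the zero algebra. -/
theorem subsingleton_of_weyl_zero {A : Type*} [Ring A] {u v : A} [Invertible u] [Invertible v]
    (h : u * v = 0) : Subsingleton A := by
  refine subsingleton_of_zero_eq_one ?_
  calc (0 : A) = ⅟u * (u * v) * ⅟v := by simp [h]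
    _ = 1 := by simp

/-- RLL relation: `R(x/y) L₁(x) L₂(y) = L₂(y) L₁(x) R(x/y)`
for the relativistic Toda chain Lax matrix and the six-vertex R-matrix. -/
theorem RLL_relation_relativistic_Toda {A : Type*} [Ring A] [Algebra ℂ A]
    (q p lam : ℂ) (hp : p ^ 2 = q)
    (u v : A) [Invertible u] [Invertible v]
    (hweyl : u * v = p • (v * u)) :
    ∀ x y : ℂ, x ≠ 0 → y ≠ 0 →
      (sixVertexR q p (x / y)).map (algebraMap ℂ A) *
          (todaLax p lam u v x ⊗ₖ (1 : Matrix (Fin 2) (Fin 2) A)) *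
          ((1 : Matrix (Fin 2) (Fin 2) A) ⊗ₖ todaLax p lam u v y) =
        ((1 : Matrix (Fin 2) (Fin 2) A) ⊗ₖ todaLax p lam u v y) *
          (todaLax p lam u v x ⊗ₖ (1 : Matrix (Fin 2) (Fin 2) A)) *
          (sixVertexR q p (x / y)).map (algebraMap ℂ A) := by
  intro x y hx hy
  rcases eq_or_ne p 0 with rfl | hp0
  · have := subsingleton_of_weyl_zero (hweyl.trans (zero_smul ℂ _))
    exact Subsingleton.elim _ _
  subst hp
  have h₁ := invOf_mul_of_weyl hp0 hweyl
  have h₂ := mul_invOf_of_weyl hp0 hweyl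
  have h₃ : ⅟u * ⅟v = p • (⅟v * ⅟u) := by
    simpa using invOf_mul_of_weyl (inv_ne_zero hp0) h₂
  ext ⟨i, k⟩ ⟨j, l⟩
  fin_cases i <;> fin_cases k <;> fin_cases j <;> fin_cases l <;>
    simp [Matrix.mul_apply, Fintype.sum_prod_type, sixVertexR, todaLax, Matrix.one_apply,
      -map_sub, -map_mul, ← Algebra.smul_def,
      ← Algebra.commutes, mul_sub, sub_mul, hweyl, h₁, h₂, h₃] <;>
    (match_scalars <;> field_simp <;> ring)
end

section
/- (Commutativity of transfer matrices.) Let A be a complex unital algebra, q ∈ ℂ, p ∈ ℂ with p² = q, λ ∈ ℂ, F ≥ 1, and let u_1, v_1, …, u_F, v_F ∈ A be invertible with u_f v_f = p v_f u_f for each f, elements of different sites commuting. Let L_f(x) be the 2×2 matrix over A with entries x u_f − (x u_f)^{−1}, v_f, p^{−1} λ v_f^{−1}, 0, and T(x) = (−x)^F (∏_f u_f) · tr(L_1(x) ⋯ L_F(x)). Then for all nonzero x, y ∈ ℂ: T(x) T(y) = T(y) T(x). -/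
open Matrix

/-- The local Lax matrix of site `f`, with explicit inverses `ui = u⁻¹`, `vi = v⁻¹`:
`L_f(x) = [[x u_f − x⁻¹ u_f⁻¹, v_f], [p⁻¹ λ v_f⁻¹, 0]]`. -/
noncomputable def todaLaxSite {A : Type*} [Ring A] [Algebra ℂ A]
    (p lam : ℂ) (u ui v vi : A) (x : ℂ) : Matrix (Fin 2) (Fin 2) A :=
  !![x • u - x⁻¹ • ui, v; (p⁻¹ * lam) • vi, 0]

/-- The transfer matrix `T(x) = (−x)^F (∏_f u_f) · tr(L₁(x) ⋯ L_F(x))`. -/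
noncomputable def todaTransfer {A : Type*} [Ring A] [Algebra ℂ A] (F : ℕ)
    (p lam : ℂ) (u ui v vi : Fin F → A) (x : ℂ) : A :=
  (-x) ^ F • ((List.ofFn u).prod *
    Matrix.trace ((List.ofFn fun f => todaLaxSite p lam (u f) (ui f) (v f) (vi f) x).prod))

open Polynomial in
/-- An `A`-valued polynomial function of a scalar variable that vanishes off the zeros of a nonzero
complex polynomial vanishes identically. -/
theorem sum_smul_eq_zero_of_generic {A : Type*} [AddCommGroup A] [Module ℂ A]
    (s : Finset ℕ) (c : ℕ → A) (D : ℂ[X]) (hD : D ≠ 0)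
    (h : ∀ x : ℂ, D.eval x ≠ 0 → ∑ k ∈ s, x ^ k • c k = 0) (x : ℂ) :
    ∑ k ∈ s, x ^ k • c k = 0 := by
  rw [← Module.forall_dual_apply_eq_zero_iff ℂ]
  intro φ
  have key : ∀ z : ℂ, (∑ k ∈ s, C (φ (c k)) * X ^ k : ℂ[X]).eval z
      = φ (∑ k ∈ s, z ^ k • c k) := by
    intro z
    rw [eval_finsetSum, map_sum]
    refine Finset.sum_congr rfl fun k _ => ?_
    rw [eval_mul, eval_C, eval_pow, eval_X, map_smul, smul_eq_mul, mul_comm]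
  have hzero : (∑ k ∈ s, C (φ (c k)) * X ^ k : ℂ[X]) * D = 0 := by
    refine Polynomial.funext fun z => ?_
    by_cases hz : D.eval z = 0
    · simp [hz]
    · rw [eval_mul, key, h z hz]
      simp
  rw [← key, (mul_eq_zero.mp hzero).resolve_right hD, eval_zero]

/-- The entries of a product of matrices commute with whatever commutes with the entries of the
factors. -/
theorem commute_list_prod_entry {A ι n : Type*} [Ring A] [Fintype n] [DecidableEq n]
    (M : ι → Matrix n n A) (l : List ι) (a : A)
    (h : ∀ g ∈ l, ∀ i j, Commute a (M g i j)) (i j : n) :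
    Commute a ((l.map M).prod i j) := by
  induction l generalizing i j with
  | nil =>
    by_cases hij : i = j <;> simp [hij]
  | cons f l ih =>
    rw [List.map_cons, List.prod_cons, Matrix.mul_apply]
    refine Commute.sum_right _ _ _ fun k _ => (h f (by simp) i k).mul_right ?_
    exact ih (fun g hg => h g (by simp [hg])) k j

/-- The product `M₁ N₂` of two matrices acting in different tensor factors. -/
def tensorLeft {A n : Type*} [Mul A] (M N : Matrix n n A) : Matrix (n × n) (n × n) A :=
  fun i j => M i.1 j.1 * N i.2 j.2

/-- The product `N₂ M₁` of two matrices acting in different tensor factors. -/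
def tensorRight {A n : Type*} [Mul A] (M N : Matrix n n A) : Matrix (n × n) (n × n) A :=
  fun i j => N i.2 j.2 * M i.1 j.1

theorem tensorLeft_mul {A n : Type*} [Ring A] [Fintype n] (M M' N N' : Matrix n n A)
    (h : ∀ i j k l, Commute (M' i j) (N k l)) :
    tensorLeft (M * M') (N * N') = tensorLeft M N * tensorLeft M' N' := by
  ext i j
  simp only [tensorLeft, Matrix.mul_apply, Fintype.sum_prod_type, Finset.sum_mul_sum]
  refine Finset.sum_congr rfl fun a _ => Finset.sum_congr rfl fun b _ => ?_
  simp only [mul_assoc]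
  rw [← mul_assoc (M' _ _), (h _ _ _ _).eq, mul_assoc]

theorem tensorRight_mul {A n : Type*} [Ring A] [Fintype n] (M M' N N' : Matrix n n A)
    (h : ∀ i j k l, Commute (M i j) (N' k l)) :
    tensorRight (M * M') (N * N') = tensorRight M N * tensorRight M' N' := by
  ext i j
  simp only [tensorRight, Matrix.mul_apply, Fintype.sum_prod_type, Finset.sum_mul_sum]
  rw [Finset.sum_comm]
  refine Finset.sum_congr rfl fun a _ => Finset.sum_congr rfl fun b _ => ?_
  simp only [mul_assoc]
  rw [← mul_assoc (N' _ _), ← (h _ _ _ _).eq, mul_assoc]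

theorem tensorLeft_one {A n : Type*} [Ring A] [DecidableEq n] :
    tensorLeft (1 : Matrix n n A) 1 = 1 := by
  ext i j
  simp only [tensorLeft, Matrix.one_apply, Prod.ext_iff]
  split_ifs <;> simp_all

theorem tensorRight_one {A n : Type*} [Ring A] [DecidableEq n] :
    tensorRight (1 : Matrix n n A) 1 = 1 := by
  ext i j
  simp only [tensorRight, Matrix.one_apply, Prod.ext_iff]
  split_ifs <;> simp_all

theorem trace_tensorLeft {A n : Type*} [Ring A] [Fintype n] (M N : Matrix n n A) :
    (tensorLeft M N).trace = M.trace * N.trace := by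
  simp [Matrix.trace, tensorLeft, Fintype.sum_prod_type, Finset.sum_mul_sum]

theorem trace_tensorRight {A n : Type*} [Ring A] [Fintype n] (M N : Matrix n n A) :
    (tensorRight M N).trace = N.trace * M.trace := by
  simp only [Matrix.trace, tensorRight, Fintype.sum_prod_type, Finset.sum_mul_sum,
    Matrix.diag_apply]
  rw [Finset.sum_comm]

/-- An exchange relation that holds at each site holds for the monodromy matrices of an ultralocal
chain. -/
theorem exchange_list_prod {A ι n : Type*} [Ring A] [Fintype n] [DecidableEq n]
    (R : Matrix (n × n) (n × n) A) (M N : ι → Matrix n n A)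
    (hR : ∀ f, R * tensorLeft (M f) (N f) = tensorRight (M f) (N f) * R)
    (hMN : ∀ f g, f ≠ g → ∀ i j k l, Commute (M f i j) (N g k l))
    (l : List ι) (hl : l.Nodup) :
    R * tensorLeft (l.map M).prod (l.map N).prod
      = tensorRight (l.map M).prod (l.map N).prod * R := by
  induction l with
  | nil => simp [tensorLeft_one, tensorRight_one]
  | cons f l ih =>
    obtain ⟨hf, hl⟩ := List.nodup_cons.mp hl
    have hne : ∀ g ∈ l, g ≠ f := fun g hg h => hf (h ▸ hg)
    simp only [List.map_cons, List.prod_cons]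
    rw [tensorLeft_mul, tensorRight_mul, ← mul_assoc, hR, mul_assoc, ih hl, mul_assoc]
    · exact fun i j k m => commute_list_prod_entry N l _
        (fun g hg _ _ => hMN f g (hne g hg).symm _ _ _ _) k m
    · exact fun i j k m => (commute_list_prod_entry M l _
        (fun g hg _ _ => (hMN g f (hne g hg) _ _ _ _).symm) i j).symm

theorem trace_map_algebraMap_mul_comm {A n : Type*} [Ring A] [Algebra ℂ A] [Fintype n]
    (S : Matrix n n ℂ) (X : Matrix n n A) :
    (S.map (algebraMap ℂ A) * X).trace = (X * S.map (algebraMap ℂ A)).trace := by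
  simp only [Matrix.trace, Matrix.diag_apply, Matrix.mul_apply, Matrix.map_apply]
  rw [Finset.sum_comm]
  simp only [Algebra.commutes]

/-- The six-vertex matrix with weights `α`, `β`, `γ`. -/
def sixVertex (α β γ : ℂ) : Matrix (Fin 2 × Fin 2) (Fin 2 × Fin 2) ℂ :=
  fun i j => if i.1 = i.2 then (if i = j then α else 0)
    else if i = j then β else if i = j.swap then γ else 0

theorem sixVertex_mul_sixVertex (α β γ : ℂ) :
    sixVertex α β γ * sixVertex (β ^ 2 - γ ^ 2) (α * β) (-(α * γ))
      = (α * (β ^ 2 - γ ^ 2)) • (1 : Matrix (Fin 2 × Fin 2) (Fin 2 × Fin 2) ℂ) := by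
  ext ⟨i, j⟩ ⟨k, l⟩
  fin_cases i <;> fin_cases j <;> fin_cases k <;> fin_cases l <;>
    simp [sixVertex, Matrix.mul_apply, Fintype.sum_prod_type] <;> ring

theorem trace_mul_trace_comm_of_exchange {A : Type*} [Ring A] [Algebra ℂ A]
    (α β γ : ℂ) (hα : α ≠ 0) (hβγ : β ^ 2 - γ ^ 2 ≠ 0) (M N : Matrix (Fin 2) (Fin 2) A)
    (h : (sixVertex α β γ).map (algebraMap ℂ A) * tensorLeft M N
      = tensorRight M N * (sixVertex α β γ).map (algebraMap ℂ A)) :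
    M.trace * N.trace = N.trace * M.trace := by
  set δ : ℂ := α * (β ^ 2 - γ ^ 2)
  have hδ0 : δ ≠ 0 := mul_ne_zero hα hβγ
  set R := sixVertex α β γ
  set S := sixVertex (β ^ 2 - γ ^ 2) (α * β) (-(α * γ))
  have hRS : R * S = δ • 1 := sixVertex_mul_sixVertex α β γ
  have hSR : S * R = δ • 1 := by
    have h1 : R * (δ⁻¹ • S) = 1 := by simp [hRS, smul_smul, hδ0]
    have h2 := mul_eq_one_comm.mp h1
    rw [← smul_inv_smul₀ hδ0 (S * R), ← smul_mul_assoc, h2]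
  have hmap : ∀ X : Matrix (Fin 2 × Fin 2) (Fin 2 × Fin 2) A,
      (δ • (1 : Matrix (Fin 2 × Fin 2) (Fin 2 × Fin 2) ℂ)).map (algebraMap ℂ A) * X = δ • X := by
    intro X
    ext i j
    rw [← Matrix.diagonal_one, ← Matrix.diagonal_smul, Matrix.diagonal_map (map_zero _),
      Matrix.diagonal_mul]
    simp [Algebra.smul_def]
  have hmapmul : ∀ P Q : Matrix (Fin 2 × Fin 2) (Fin 2 × Fin 2) ℂ,
      (P * Q).map (algebraMap ℂ A) = P.map (algebraMap ℂ A) * Q.map (algebraMap ℂ A) :=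
    fun P Q => Matrix.map_mul
  have key : δ • (tensorLeft M N).trace = δ • (tensorRight M N).trace := by
    rw [← Matrix.trace_smul, ← Matrix.trace_smul, ← hmap, ← hmap]
    nth_rewrite 1 [← hSR]
    rw [← hRS, hmapmul, hmapmul, mul_assoc, h, trace_map_algebraMap_mul_comm, mul_assoc,
      ← hmapmul, trace_map_algebraMap_mul_comm]
  rw [trace_tensorLeft, trace_tensorRight] at key
  exact smul_right_injective A hδ0 key

/-- The exchange relation for the Lax matrix of one site. -/
theorem todaLaxSite_exchange {A : Type*} [Ring A] [Algebra ℂ A] (p lam : ℂ) (hp : p ≠ 0)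
    (u ui v vi : A) (hv : v * vi = 1) (hv' : vi * v = 1)
    (huv : u * v = p • (v * u)) (huiv : ui * v = p⁻¹ • (v * ui))
    (huvi : u * vi = p⁻¹ • (vi * u)) (huivi : ui * vi = p • (vi * ui))
    (huui : u * ui = 1) (huiu : ui * u = 1)
    (x y : ℂ) (hx : x ≠ 0) (hy : y ≠ 0) :
    (sixVertex (x ^ 2 - p ^ 2 * y ^ 2) (p * (x ^ 2 - y ^ 2)) ((1 - p ^ 2) * x * y)).map
        (algebraMap ℂ A) *
        tensorLeft (todaLaxSite p lam u ui v vi x) (todaLaxSite p lam u ui v vi y)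
      = tensorRight (todaLaxSite p lam u ui v vi x) (todaLaxSite p lam u ui v vi y) *
        (sixVertex (x ^ 2 - p ^ 2 * y ^ 2) (p * (x ^ 2 - y ^ 2)) ((1 - p ^ 2) * x * y)).map
          (algebraMap ℂ A) := by
  ext ⟨i, j⟩ ⟨k, l⟩
  simp only [Matrix.mul_apply, Matrix.map_apply, ← Algebra.commutes, ← Algebra.smul_def]
  fin_cases i <;> fin_cases j <;> fin_cases k <;> fin_cases l <;>
    simp [sixVertex, Fintype.sum_prod_type, tensorLeft, tensorRight, todaLaxSite,
      mul_sub, sub_mul, huv, huiv, huvi, huivi, hv, hv', huui, huiu, smul_smul] <;>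
    try (match_scalars <;> field_simp <;> ring)

/-- Conjugation by an element acting diagonally with weights `w` fixes the trace of a product of
matrices. -/
theorem commute_trace_list_prod_of_weight {A ι n : Type*} [Ring A] [Algebra ℂ A] [Fintype n]
    [DecidableEq n] (U : A) (w : n → ℂ) (hw : ∀ i, w i ≠ 0) (M : ι → Matrix n n A)
    (hM : ∀ f i j, U * M f i j = (w i / w j) • (M f i j * U)) (l : List ι) :
    Commute U (l.map M).prod.trace := by
  have key : ∀ i j, U * (l.map M).prod i j = (w i / w j) • ((l.map M).prod i j * U) := by
    induction l with
    | nil =>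
      intro i j
      by_cases hij : i = j
      · subst hij
        simp [hw i]
      · simp [hij]
    | cons f l ih =>
      intro i j
      simp only [List.map_cons, List.prod_cons, Matrix.mul_apply, Finset.mul_sum, Finset.sum_mul,
        Finset.smul_sum]
      refine Finset.sum_congr rfl fun k _ => ?_
      rw [← mul_assoc, hM, smul_mul_assoc, mul_assoc, ih, mul_smul_comm, smul_smul, mul_assoc,
        div_mul_div_cancel₀ (hw k)]
  refine Commute.sum_right _ _ _ fun i _ => ?_
  have := key i i
  rwa [div_self (hw i), one_smul] at this

/-- If `a` commutes with every factor but the one at `f`, with which it commutes up to `p`, then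
it commutes with the product up to `p`. -/
theorem list_prod_mul_of_weyl {A ι : Type*} [Ring A] [Algebra ℂ A] (u : ι → A) (a : A) (p : ℂ)
    (f : ι) (hf : u f * a = p • (a * u f)) (hne : ∀ g, g ≠ f → Commute (u g) a)
    (l : List ι) (hl : l.Nodup) (hfl : f ∈ l) :
    (l.map u).prod * a = p • (a * (l.map u).prod) := by
  induction l with
  | nil => simp at hfl
  | cons g l ih =>
    obtain ⟨hg, hl⟩ := List.nodup_cons.mp hl
    rw [List.map_cons, List.prod_cons]
    by_cases hgf : g = f
    · subst hgf
      have hc : Commute (l.map u).prod a := by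
        refine Commute.list_prod_left _ _ fun b hb => ?_
        obtain ⟨k, hk, rfl⟩ := List.mem_map.mp hb
        exact hne k fun h => hg (h ▸ hk)
      rw [mul_assoc, hc.eq, ← mul_assoc, hf, smul_mul_assoc, mul_assoc]
    · have hfl' : f ∈ l := (List.mem_cons.mp hfl).resolve_left fun h => hgf h.symm
      rw [mul_assoc, ih hl hfl', mul_smul_comm, ← mul_assoc, (hne g hgf).eq, mul_assoc]

open Polynomial in
/-- The transfer matrix is a polynomial function of the spectral parameter. -/
theorem exists_todaTransfer_eq_sum {A : Type*} [Ring A] [Algebra ℂ A] (F : ℕ) (p lam : ℂ)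
    (u ui v vi : Fin F → A) :
    ∃ (s : Finset ℕ) (c : ℕ → A), ∀ x : ℂ, x ≠ 0 →
      todaTransfer F p lam u ui v vi x = ∑ k ∈ s, x ^ k • c k := by
  let L : Fin F → Matrix (Fin 2) (Fin 2) A[X] := fun f =>
    !![C (u f) * X ^ 2 - C (ui f), C (v f) * X; C ((p⁻¹ * lam) • vi f) * X, 0]
  let P : A[X] := C ((-1 : A) ^ F * (List.ofFn u).prod) * (List.ofFn L).prod.trace
  refine ⟨P.support, P.coeff, fun x hx => ?_⟩
  let φ : A[X] →+* A := eval₂RingHom' (RingHom.id A) (algebraMap ℂ A x)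
    fun a => (Algebra.commutes x a).symm
  have hφC : ∀ a, φ (C a) = a := fun a => eval₂_C _ _
  have hφX : φ X = algebraMap ℂ A x := eval₂_X _ _
  have hsum : φ P = ∑ k ∈ P.support, x ^ k • P.coeff k := by
    change eval₂ (RingHom.id A) (algebraMap ℂ A x) P = _
    rw [eval₂_eq_sum, Polynomial.sum]
    refine Finset.sum_congr rfl fun k _ => ?_
    rw [RingHom.id_apply, ← map_pow, ← Algebra.commutes, ← Algebra.smul_def]
  have hL : ∀ f, φ.mapMatrix (L f)
      = x • todaLaxSite p lam (u f) (ui f) (v f) (vi f) x := by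
    intro f
    ext i j
    fin_cases i <;> fin_cases j <;>
      simp [L, todaLaxSite, hφC, hφX, smul_sub, smul_smul, ← Algebra.commutes,
        ← Algebra.smul_def, hx, pow_two, mul_comm x]
  have hprod : ∀ l : List (Fin F), φ.mapMatrix (l.map L).prod = x ^ l.length •
      (l.map fun f => todaLaxSite p lam (u f) (ui f) (v f) (vi f) x).prod := by
    intro l
    induction l with
    | nil => simp
    | cons f l ih =>
      rw [List.map_cons, List.prod_cons, map_mul, ih, hL, List.map_cons, List.prod_cons,
        List.length_cons, smul_mul_smul_comm, pow_succ']
  rw [← hsum, map_mul, hφC]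
  have htr : φ (List.ofFn L).prod.trace = (φ.mapMatrix (List.ofFn L).prod).trace := by
    simp [Matrix.trace]
  rw [htr, List.ofFn_eq_map (f := L), hprod, List.length_finRange, Matrix.trace_smul, todaTransfer,
    List.ofFn_eq_map (f := fun f => todaLaxSite p lam (u f) (ui f) (v f) (vi f) x), neg_pow, mul_smul_comm, mul_smul, smul_comm]
  congr 1
  rw [mul_assoc, Algebra.smul_def]
  simp

/-- commutativity of transfer matrices: `T(x) T(y) = T(y) T(x)`
for all nonzero `x, y ∈ ℂ`. -/
theorem transfer_matrices_commute
    {A : Type*} [Ring A] [Algebra ℂ A]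
    (F : ℕ) (hF : 1 ≤ F) (q p lam : ℂ) (hp : p ^ 2 = q)
    (u ui v vi : Fin F → A)
    (hu : ∀ f, u f * ui f = 1) (hu' : ∀ f, ui f * u f = 1)
    (hv : ∀ f, v f * vi f = 1) (hv' : ∀ f, vi f * v f = 1)
    (hweyl : ∀ f, u f * v f = p • (v f * u f))
    (hultra : ∀ f g, f ≠ g → ∀ a ∈ ({u f, ui f, v f, vi f} : Set A),
      ∀ b ∈ ({u g, ui g, v g, vi g} : Set A), Commute a b) :
    ∀ x y : ℂ, x ≠ 0 → y ≠ 0 →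
      todaTransfer F p lam u ui v vi x * todaTransfer F p lam u ui v vi y =
        todaTransfer F p lam u ui v vi y * todaTransfer F p lam u ui v vi x := by
  intro x y hx hy
  rcases subsingleton_or_nontrivial A with _ | _
  · exact Subsingleton.elim _ _
  have hp0 : p ≠ 0 := by
    rintro rfl
    have h : ui ⟨0, hF⟩ * (u ⟨0, hF⟩ * v ⟨0, hF⟩) * vi ⟨0, hF⟩ = 1 := by
      rw [← mul_assoc, hu', one_mul, hv]
    rw [hweyl, zero_smul, mul_zero, zero_mul] at h
    exact zero_ne_one h
  set L : ℂ → Fin F → Matrix (Fin 2) (Fin 2) A :=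
    fun x f => todaLaxSite p lam (u f) (ui f) (v f) (vi f) x with hLdef
  have hT : ∀ x, todaTransfer F p lam u ui v vi x = (-x) ^ F •
      (((List.finRange F).map u).prod * ((List.finRange F).map (L x)).prod.trace) := by
    intro x
    rw [todaTransfer, List.ofFn_eq_map, List.ofFn_eq_map]
  set U := ((List.finRange F).map u).prod
  have hUv : ∀ f, U * v f = p • (v f * U) := fun f =>
    list_prod_mul_of_weyl u (v f) p f (hweyl f)
      (fun g hg => hultra g f hg _ (by simp) _ (by simp)) _ (List.nodup_finRange F) (by simp)
  have inv_right : ∀ (a : A) (f : Fin F), a * v f = p • (v f * a) →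
      a * vi f = p⁻¹ • (vi f * a) := by
    intro a f h
    have h1 : vi f * a = p • (a * vi f) := by
      calc vi f * a = vi f * (a * v f) * vi f := by rw [mul_assoc, mul_assoc, hv, mul_one]
        _ = p • (vi f * v f * (a * vi f)) := by
          rw [h, mul_smul_comm, smul_mul_assoc]
          simp only [mul_assoc]
        _ = p • (a * vi f) := by rw [hv', one_mul]
    rw [h1, inv_smul_smul₀ hp0]
  have hUvi : ∀ f, U * vi f = p⁻¹ • (vi f * U) := fun f => inv_right U f (hUv f)
  have huiv : ∀ f, ui f * v f = p⁻¹ • (v f * ui f) := by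
    intro f
    have h1 : v f * ui f = p • (ui f * v f) := by
      calc v f * ui f = ui f * (u f * v f) * ui f := by rw [← mul_assoc, hu', one_mul]
        _ = p • (ui f * v f * (u f * ui f)) := by
          rw [hweyl, mul_smul_comm, smul_mul_assoc]
          simp only [mul_assoc]
        _ = p • (ui f * v f) := by rw [hu, mul_one]
    rw [h1, inv_smul_smul₀ hp0]
  have huivi : ∀ f, ui f * vi f = p • (vi f * ui f) := by
    intro f
    have h1 : vi f * ui f = p⁻¹ • (ui f * vi f) := by
      calc vi f * ui f = vi f * (ui f * v f) * vi f := by rw [mul_assoc, mul_assoc, hv, mul_one]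
        _ = p⁻¹ • (vi f * v f * (ui f * vi f)) := by
          rw [huiv, mul_smul_comm, smul_mul_assoc]
          simp only [mul_assoc]
        _ = p⁻¹ • (ui f * vi f) := by rw [hv', one_mul]
    rw [h1, smul_inv_smul₀ hp0]
  have hUu : ∀ f, Commute U (u f) := by
    intro f
    refine Commute.list_prod_left _ _ fun b hb => ?_
    obtain ⟨g, -, rfl⟩ := List.mem_map.mp hb
    by_cases hgf : g = f
    · rw [hgf]
      exact Commute.refl _
    · exact hultra g f hgf _ (by simp) _ (by simp)
  have hUui : ∀ f, Commute U (ui f) := by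
    intro f
    refine Commute.list_prod_left _ _ fun b hb => ?_
    obtain ⟨g, -, rfl⟩ := List.mem_map.mp hb
    by_cases hgf : g = f
    · rw [hgf]
      exact (hu f).trans (hu' f).symm
    · exact hultra g f hgf _ (by simp) _ (by simp)
  have hUt : ∀ x, Commute U ((List.finRange F).map (L x)).prod.trace := by
    intro x
    refine commute_trace_list_prod_of_weight U ![p, 1] ?_ (L x) ?_ _
    · intro i
      fin_cases i <;> simp [hp0]
    · intro f i j
      fin_cases i <;> fin_cases j <;>
        simp [hLdef, todaLaxSite, hUv, hUvi, hp0, mul_sub, sub_mul, (hUu f).eq, (hUui f).eq,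
          smul_smul, mul_comm]
  have hultraL : ∀ x y : ℂ, ∀ f g, f ≠ g → ∀ i j k l, Commute (L x f i j) (L y g k l) := by
    intro x y f g hfg
    have hc : ∀ (z : A), (∀ b ∈ ({u g, ui g, v g, vi g} : Set A), Commute z b) →
        ∀ k l, Commute z (L y g k l) := by
      intro z hz k l
      fin_cases k <;> fin_cases l
      · exact ((hz _ (by simp)).smul_right _).sub_right ((hz _ (by simp)).smul_right _)
      · exact hz _ (by simp [hLdef, todaLaxSite])
      · exact (hz _ (by simp)).smul_right _
      · exact Commute.zero_right _
    intro i j k l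
    have hz : ∀ a ∈ ({u f, ui f, v f, vi f} : Set A), Commute a (L y g k l) :=
      fun a ha => hc a (fun b hb => hultra f g hfg a ha b hb) k l
    fin_cases i <;> fin_cases j
    · exact ((hz _ (by simp)).smul_left _).sub_left ((hz _ (by simp)).smul_left _)
    · exact hz _ (by simp [hLdef, todaLaxSite])
    · exact (hz _ (by simp)).smul_left _
    · exact Commute.zero_left _
  have hgen : ∀ x : ℂ, x ≠ 0 → x ^ 2 - p ^ 2 * y ^ 2 ≠ 0 → p ^ 2 * x ^ 2 - y ^ 2 ≠ 0 →
      Commute (todaTransfer F p lam u ui v vi x) (todaTransfer F p lam u ui v vi y) := by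
    intro x hx h1 h2
    have ht : Commute ((List.finRange F).map (L x)).prod.trace
        ((List.finRange F).map (L y)).prod.trace := by
      refine trace_mul_trace_comm_of_exchange (x ^ 2 - p ^ 2 * y ^ 2) (p * (x ^ 2 - y ^ 2))
        ((1 - p ^ 2) * x * y) h1 ?_ _ _ (exchange_list_prod _ _ _ (fun f => ?_)
          (hultraL x y) _ (List.nodup_finRange F))
      · convert mul_ne_zero h1 h2 using 1
        ring
      · exact todaLaxSite_exchange p lam hp0 _ _ _ _ (hv f) (hv' f) (hweyl f) (huiv f)
          (inv_right _ f (hweyl f)) (huivi f) (hu f) (hu' f) x y hx hy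
    rw [hT, hT]
    exact ((((Commute.refl U).mul_right (hUt y)).mul_left
      ((hUt x).symm.mul_right ht)).smul_left _).smul_right _
  obtain ⟨s, c, hc⟩ := exists_todaTransfer_eq_sum F p lam u ui v vi
  set t := todaTransfer F p lam u ui v vi y
  have hexp : ∀ z : ℂ, z ≠ 0 → todaTransfer F p lam u ui v vi z * t -
      t * todaTransfer F p lam u ui v vi z = ∑ k ∈ s, z ^ k • (c k * t - t * c k) := by
    intro z hz
    simp [hc z hz, Finset.sum_mul, Finset.mul_sum, smul_sub]
  rw [← sub_eq_zero, hexp x hx]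
  refine sum_smul_eq_zero_of_generic s _
    (Polynomial.X * (Polynomial.X ^ 2 - Polynomial.C (p ^ 2 * y ^ 2)) *
      (Polynomial.C (p ^ 2) * Polynomial.X ^ 2 - Polynomial.C (y ^ 2))) ?_ (fun z hz => ?_) x
  · refine mul_ne_zero (mul_ne_zero Polynomial.X_ne_zero ?_) ?_
    · exact Polynomial.X_pow_sub_C_ne_zero two_pos _
    · intro h
      have := congrArg (Polynomial.eval 0) h
      simp [hy] at this
  · simp only [Polynomial.eval_mul, Polynomial.eval_sub, Polynomial.eval_pow, Polynomial.eval_X,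
      Polynomial.eval_C, mul_ne_zero_iff] at hz
    rw [← hexp z hz.1.1, sub_eq_zero]
    exact hgen z hz.1.1 hz.1.2 hz.2
end

section
/- (Zero-curvature compatibility.) Let q, λ ∈ ℂ be nonzero, p ∈ ℂ with p² = q, and define φ(u) = −p^{−1} u^{−1} for u ∈ ℂ, u ≠ 0. For t ∈ ℂ set [N] := −p λ^{−1}(1 − t) and [N−1] := −p λ^{−1}(1 − q t) (t playing the role of q^{−N}). Then for every u ∈ ℂ with u ≠ 0 and every t ∈ ℂ: p^{−1} λ ( [N]/φ(p u) − [N−1]/φ(p^{−1} u) ) = u^{−1} ( 1 − p^{−1} φ(u)/φ(p u) ) − u ( 1 − p φ(u)/φ(p u) ). -/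
/-- `φ(u) = −p⁻¹ u⁻¹`, the paper's solution of the zero-curvature condition. -/
noncomputable def phiFun (p u : ℂ) : ℂ := -p⁻¹ * u⁻¹

/-- zero-curvature compatibility: with `φ(u) = −p⁻¹ u⁻¹`,
`[N] = −p λ⁻¹ (1 − t)` and `[N−1] = −p λ⁻¹ (1 − q t)` (`t` playing the role of `q^{−N}`),
`p⁻¹ λ ([N]/φ(p u) − [N−1]/φ(p⁻¹ u)) = u⁻¹(1 − p⁻¹ φ(u)/φ(p u)) − u(1 − p φ(u)/φ(p u))`. -/
theorem zero_curvature_compatibility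
    (q lam p : ℂ) (hq : q ≠ 0) (hlam : lam ≠ 0) (hp : p ^ 2 = q)
    (u t : ℂ) (hu : u ≠ 0) :
    p⁻¹ * lam * ((-p * lam⁻¹ * (1 - t)) / phiFun p (p * u) -
        (-p * lam⁻¹ * (1 - q * t)) / phiFun p (p⁻¹ * u)) =
      u⁻¹ * (1 - p⁻¹ * (phiFun p u / phiFun p (p * u))) -
        u * (1 - p * (phiFun p u / phiFun p (p * u))) := by
  subst hp
  have hp0 : p ≠ 0 := by
    rintro rfl
    simp at hq
  unfold phiFun
  field_simp
  ring
end
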